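/- Let H be a finitely generated nilpotent group with finite symmetric generating set, word metric d, and polynomial volume growth of order D. Let z ∈ H be a central element of infinite order such that for some real k ≥ 2 there are constants 0 < c ≤ C with c·|l|^{1/k} ≤ d(e, z^l) ≤ C·|l|^{1/k} for all integers l ≠ 0. Let p be the lazy simple random walk measure, p(g) = 1/(2d'+1) for g in the set consisting of the identity and the generators and their inverses (where d' is the number of generators), and p(g) = 0 otherwise. Then the conditional expected power of z after n steps satisfies (Σ_{l∈ℤ} |l| · p^{(n)}(z^l)) / (Σ_{l∈ℤ} p^{(n)}(z^l)) = Ω(n^{k/2}). -/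

import Mathlib

namespace AvgDehnPaper

variable {H : Type*} [Group H]

/-- The word length of `g` for the symmetric generating set `{e_i^{±1}}`. -/
noncomputable def wordLength {d' : ℕ} (e : Fin d' → H) (g : H) : ℕ :=
  sInf { k | ∃ l : List H, l.length = k ∧
    (∀ x ∈ l, ∃ i, x = e i ∨ x = (e i)⁻¹) ∧ l.prod = g }

/-- Convolution of two functions on a group. -/
noncomputable def conv (p q : H → ℝ) : H → ℝ := fun x => ∑ᶠ y, p y * q (y⁻¹ * x)

open scoped Classical in
/-- Convolution powers: `convPow p n x = p^{(n)}(x)`, the probability that an `n`-step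
random walk with step distribution `p` starting at `e` ends at `x`. -/
noncomputable def convPow (p : H → ℝ) : ℕ → H → ℝ
  | 0 => fun x => if x = 1 then 1 else 0
  | n + 1 => conv p (convPow p n)

open scoped Classical in
/-- The lazy simple random walk measure: `p(g) = 1/(2d'+1)` if `g` is the identity, a
generator, or an inverse of a generator, and `p(g) = 0` otherwise. -/
noncomputable def lazySRW {d' : ℕ} (e : Fin d' → H) : H → ℝ :=
  fun g => if g = 1 ∨ ∃ i, g = e i ∨ g = (e i)⁻¹ then 1 / (2 * (d' : ℝ) + 1) else 0

open Finset


section Pairing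
variable {X : Type*}

/-- The standard inner product of finitely supported real functions. -/
noncomputable def pairing : (X →₀ ℝ) →ₗ[ℝ] (X →₀ ℝ) →ₗ[ℝ] ℝ :=
  LinearMap.mk₂ ℝ (fun f g => f.sum fun x a => a * g x)
    (fun f f' g => Finsupp.sum_add_index' (by simp) (by intros; ring))
    (fun c f g => by
      rw [Finsupp.sum_smul_index (by simp), Finsupp.smul_sum]
      simp [mul_assoc])
    (fun f g g' => by simp [Finsupp.sum, mul_add, sum_add_distrib])
    (fun c f g => by simp [Finsupp.sum, mul_sum, mul_left_comm])

theorem pairing_eq_sum {f g : X →₀ ℝ} {U : Finset X} (hU : f.support ⊆ U) :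
    pairing f g = ∑ x ∈ U, f x * g x :=
  Finsupp.sum_of_support_subset f hU (fun x a => a * g x) (by simp)

theorem pairing_comm (f g : X →₀ ℝ) : pairing f g = pairing g f := by
  classical
  rw [pairing_eq_sum (U := f.support ∪ g.support) subset_union_left,
    pairing_eq_sum (U := f.support ∪ g.support) subset_union_right]
  simp [mul_comm]

theorem pairing_self_nonneg (f : X →₀ ℝ) : 0 ≤ pairing f f := by
  rw [pairing_eq_sum subset_rfl]
  exact sum_nonneg fun _ _ => mul_self_nonneg _

theorem pairing_single_right (f : X →₀ ℝ) (x : X) : pairing f (Finsupp.single x 1) = f x := by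
  rw [pairing_comm]
  simp [pairing]

theorem pairing_domLCongr (e : X ≃ X) (f g : X →₀ ℝ) :
    pairing (Finsupp.domLCongr (R := ℝ) e f) (Finsupp.domLCongr (R := ℝ) e g) = pairing f g := by
  rw [pairing_eq_sum subset_rfl, pairing_eq_sum subset_rfl]
  simp [Finsupp.domLCongr, Finsupp.domCongr, Finsupp.equivMapDomain]

theorem pairing_sub_self (f g : X →₀ ℝ) :
    pairing (f - g) (f - g) = pairing f f - 2 * pairing f g + pairing g g := by
  simp only [map_sub, LinearMap.sub_apply, pairing_comm g f]
  ring

theorem two_mul_pairing_le (f g : X →₀ ℝ) :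
    2 * pairing f g ≤ pairing f f + pairing g g := by
  linarith [pairing_self_nonneg (f - g), pairing_sub_self f g]

end Pairing

section Average
variable {H G : Type*} [Group H] [Group G]

/-- Left translation of finitely supported functions. -/
noncomputable abbrev shift (s : G) : (G →₀ ℝ) ≃ₗ[ℝ] (G →₀ ℝ) :=
  Finsupp.domLCongr (Equiv.mulLeft s)

@[simp] theorem shift_apply (s : G) (f : G →₀ ℝ) (x : G) : shift s f x = f (s⁻¹ * x) := rfl

@[simp] theorem shift_one (f : G →₀ ℝ) : shift (1 : G) f = f := by
  ext x
  rw [shift_apply, inv_one, one_mul]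

theorem shift_mul (s t : G) (f : G →₀ ℝ) : shift (s * t) f = shift s (shift t f) := by
  ext x
  rw [shift_apply, shift_apply, shift_apply, mul_inv_rev, mul_assoc]

theorem pairing_shift_left (s : G) (f g : G →₀ ℝ) :
    pairing (shift s f) g = pairing f (shift s⁻¹ g) := by
  rw [← pairing_domLCongr (Equiv.mulLeft s) f]
  congr 1
  ext x
  simp

/-- The Markov operator of the image under `π` of the uniform measure on `S`. -/
noncomputable def average (S : Finset H) (π : H →* G) : Module.End ℝ (G →₀ ℝ) :=
  (#S : ℝ)⁻¹ • ∑ s ∈ S, (shift (π s)).toLinearMap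

variable {S : Finset H} {π : H →* G}

theorem average_eq (f : G →₀ ℝ) : average S π f = (#S : ℝ)⁻¹ • ∑ s ∈ S, shift (π s) f := by
  simp [average]

theorem average_apply (f : G →₀ ℝ) (x : G) :
    average S π f x = (#S : ℝ)⁻¹ * ∑ s ∈ S, f ((π s)⁻¹ * x) := by
  simp [average_eq]

theorem pairing_average_comm (hS : ∀ s ∈ S, s⁻¹ ∈ S) (f g : G →₀ ℝ) :
    pairing (average S π f) g = pairing f (average S π g) := by
  simp only [average_eq, map_smul, map_sum, LinearMap.smul_apply, LinearMap.sum_apply,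
    pairing_shift_left]
  congr 1
  exact sum_bij' (fun s _ => s⁻¹) (fun s _ => s⁻¹) hS hS (by simp) (by simp) (by simp)

theorem pairing_average_pow_comm (hS : ∀ s ∈ S, s⁻¹ ∈ S) (n : ℕ) (f g : G →₀ ℝ) :
    pairing ((average S π ^ n) f) g = pairing f ((average S π ^ n) g) := by
  induction n generalizing f g with
  | zero => simp
  | succ n ih =>
    rw [pow_succ', Module.End.mul_apply, pairing_average_comm hS, ih, ← Module.End.mul_apply,
      ← pow_succ, pow_succ']

theorem pairing_self_sub_average (hS : S.Nonempty) (f : G →₀ ℝ) :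
    pairing f f - pairing (average S π f) (average S π f) =
      (2 * (#S : ℝ) ^ 2)⁻¹ * ∑ s ∈ S, ∑ t ∈ S,
        pairing (shift (π s) f - shift (π t) f) (shift (π s) f - shift (π t) f) := by
  have hN : (#S : ℝ) ≠ 0 := by simpa using hS.ne_empty
  simp only [pairing_sub_self, pairing_domLCongr, average_eq, map_smul, map_sum,
    LinearMap.smul_apply, LinearMap.sum_apply, sum_add_distrib, sum_sub_distrib, sum_const,
    ← mul_sum, smul_eq_mul, nsmul_eq_mul]
  rw [sum_comm]
  field_simp
  ring

theorem pairing_average_le (hS : S.Nonempty) (f : G →₀ ℝ) :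
    pairing (average S π f) (average S π f) ≤ pairing f f := by
  rw [← sub_nonneg, pairing_self_sub_average hS]
  exact mul_nonneg (by positivity)
    (sum_nonneg fun _ _ => sum_nonneg fun _ _ => pairing_self_nonneg _)

/-- Convexity of `n ↦ ‖Pⁿ f‖²` for the symmetric operator `P`. -/
theorem pairing_self_sub_pow_le (hS : ∀ s ∈ S, s⁻¹ ∈ S) (f : G →₀ ℝ) (n : ℕ) :
    pairing f f - pairing ((average S π ^ n) f) ((average S π ^ n) f) ≤
      n * (pairing f f - pairing (average S π f) (average S π f)) := by
  set P := average S π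
  have hconv (n : ℕ) : pairing ((P ^ n) f) ((P ^ n) f)
      - pairing ((P ^ (n + 1)) f) ((P ^ (n + 1)) f) ≤ pairing f f - pairing (P f) (P f) := by
    induction n with
    | zero => simp
    | succ n ih =>
      have h := pairing_self_nonneg ((P ^ n) f - (P ^ (n + 2)) f)
      have h2 : pairing ((P ^ n) f) ((P ^ (n + 2)) f)
          = pairing ((P ^ (n + 1)) f) ((P ^ (n + 1)) f) := by
        rw [pow_succ' P (n + 1), pow_succ' P n, Module.End.mul_apply,
          ← pairing_average_comm hS, Module.End.mul_apply]
      rw [pairing_sub_self, h2] at h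
      linarith
  induction n with
  | zero => simp
  | succ n ih =>
    push_cast
    linarith [hconv n]

theorem average_pow_nonneg {f : G →₀ ℝ} (hf : ∀ x, 0 ≤ f x) (n : ℕ) (x : G) :
    0 ≤ (average S π ^ n) f x := by
  induction n generalizing x with
  | zero => simpa using hf x
  | succ n ih =>
    rw [pow_succ', Module.End.mul_apply, average_apply]
    exact mul_nonneg (by positivity) (sum_nonneg fun _ _ => ih _)

theorem sum_average_pow_le {f : G →₀ ℝ} {c : ℝ} (hc : 0 ≤ c)
    (hf : ∀ U : Finset G, ∑ x ∈ U, f x ≤ c)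
    (n : ℕ) (U : Finset G) : ∑ x ∈ U, (average S π ^ n) f x ≤ c := by
  induction n generalizing U with
  | zero => simpa using hf U
  | succ n ih =>
    simp only [pow_succ', Module.End.mul_apply, average_apply, ← mul_sum]
    rw [sum_comm]
    calc (#S : ℝ)⁻¹ * ∑ s ∈ S, ∑ x ∈ U, (average S π ^ n) f ((π s)⁻¹ * x)
        ≤ (#S : ℝ)⁻¹ * ∑ s ∈ S, c := by
          gcongr with s
          simpa using ih (U.map (Equiv.mulLeft (π s)⁻¹).toEmbedding)
      _ ≤ c := by
          rcases S.eq_empty_or_nonempty with rfl | h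
          · simpa
          · have hN : (#S : ℝ) ≠ 0 := by simpa using h.ne_empty
            simp [hN]

theorem average_pow_single (n : ℕ) (x : G) :
    (average S π ^ n) (Finsupp.single x 1) =
      Finsupp.domLCongr (R := ℝ) (Equiv.mulRight x)
        ((average S π ^ n) (Finsupp.single 1 1)) := by
  induction n with
  | zero => simp
  | succ n ih =>
    rw [pow_succ', Module.End.mul_apply, Module.End.mul_apply, ih]
    ext y
    simp [average_apply, Finsupp.domLCongr, Finsupp.domCongr, mul_assoc]

/-- The squared `ℓ²` norm of the distribution after `n` steps. -/
noncomputable def energy (S : Finset H) (π : H →* G) (n : ℕ) : ℝ :=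
  pairing ((average S π ^ n) (Finsupp.single 1 1)) ((average S π ^ n) (Finsupp.single 1 1))

theorem pairing_average_pow_single (n : ℕ) (x : G) :
    pairing ((average S π ^ n) (Finsupp.single x 1)) ((average S π ^ n) (Finsupp.single x 1)) =
      energy S π n := by
  rw [average_pow_single, pairing_domLCongr, energy]

theorem average_pow_two_mul_one (hS : ∀ s ∈ S, s⁻¹ ∈ S) (n : ℕ) :
    (average S π ^ (2 * n)) (Finsupp.single 1 1) 1 = energy S π n := by
  rw [← pairing_single_right, two_mul, pow_add, Module.End.mul_apply,
    pairing_average_pow_comm hS, energy]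

theorem average_pow_two_mul_le (hS : ∀ s ∈ S, s⁻¹ ∈ S) (n : ℕ) (x : G) :
    (average S π ^ (2 * n)) (Finsupp.single 1 1) x ≤ energy S π n := by
  rw [← pairing_single_right, two_mul, pow_add, Module.End.mul_apply,
    pairing_average_pow_comm hS]
  have h := two_mul_pairing_le ((average S π ^ n) (Finsupp.single 1 1))
    ((average S π ^ n) (Finsupp.single x 1))
  simp only [pairing_average_pow_single] at h
  linarith

theorem average_le_of_le (hS : S.Nonempty) {f : G →₀ ℝ} {c : ℝ} (hf : ∀ x, f x ≤ c) (x : G) :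
    average S π f x ≤ c := by
  have hN : (#S : ℝ) ≠ 0 := by simpa using hS.ne_empty
  rw [average_apply]
  calc (#S : ℝ)⁻¹ * ∑ s ∈ S, f ((π s)⁻¹ * x) ≤ (#S : ℝ)⁻¹ * ∑ s ∈ S, c := by
        gcongr; exact hf _
    _ = c := by simp [hN]

theorem inv_mul_le_average (h1 : 1 ∈ S) {f : G →₀ ℝ} (hf : ∀ x, 0 ≤ f x) (x : G) :
    (#S : ℝ)⁻¹ * f x ≤ average S π f x := by
  rw [average_apply]
  gcongr
  simpa using single_le_sum (f := fun s => f ((π s)⁻¹ * x)) (fun _ _ => hf _) h1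

theorem pairing_average_pow_le {f : G →₀ ℝ} (hf : ∀ x, 0 ≤ f x) (n : ℕ) :
    pairing ((average S π ^ n) f) ((average S π ^ n) f) ≤
      (∑ x ∈ f.support, f x) ^ 2 * energy S π n := by
  have hsum : f = ∑ x ∈ f.support, f x • Finsupp.single x (1 : ℝ) := by
    conv_lhs => rw [← f.sum_single]
    simp [Finsupp.sum]
  conv_lhs => rw [hsum]
  simp only [map_sum, map_smul, LinearMap.sum_apply, LinearMap.smul_apply, smul_eq_mul]
  simp only [sq, sum_mul, mul_sum]
  refine sum_le_sum fun x _ => sum_le_sum fun y _ => ?_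
  have h := two_mul_pairing_le ((average S π ^ n) (Finsupp.single y 1))
    ((average S π ^ n) (Finsupp.single x 1))
  simp only [pairing_average_pow_single] at h
  rw [← mul_assoc, mul_comm (f y)]
  exact mul_le_mul_of_nonneg_left (by linarith) (mul_nonneg (hf x) (hf y))

theorem mapDomain_average (f : H →₀ ℝ) :
    Finsupp.mapDomain π (average S (MonoidHom.id H) f) =
      average S π (Finsupp.mapDomain π f) := by
  have (s : H) : Finsupp.mapDomain π (shift s f) = shift (π s) (Finsupp.mapDomain π f) := by
    rw [shift, shift, Finsupp.domLCongr_apply, Finsupp.domLCongr_apply,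
      Finsupp.domCongr_apply, Finsupp.domCongr_apply,
      Finsupp.equivMapDomain_eq_mapDomain, Finsupp.equivMapDomain_eq_mapDomain,
      ← Finsupp.mapDomain_comp, ← Finsupp.mapDomain_comp]
    congr 1
    ext x
    simp
  simp only [average_eq, Finsupp.mapDomain_smul, Finsupp.mapDomain_finsetSum, this,
    MonoidHom.id_apply]

theorem mapDomain_average_pow (n : ℕ) :
    Finsupp.mapDomain π ((average S (MonoidHom.id H) ^ n) (Finsupp.single 1 1)) =
      (average S π ^ n) (Finsupp.single 1 1) := by
  induction n with
  | zero => simp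
  | succ n ih =>
    rw [pow_succ', Module.End.mul_apply, mapDomain_average, ih, pow_succ', Module.End.mul_apply]

end Average

section UpperBound
variable {H : Type*} [Group H] {S : Finset H}

theorem pairing_sub_shift_prod_le {f : H →₀ ℝ} {E : ℝ}
    (hE : ∀ s ∈ S, pairing (f - shift s f) (f - shift s f) ≤ E)
    (l : List H) (hl : ∀ s ∈ l, s ∈ S) :
    pairing (f - shift l.prod f) (f - shift l.prod f) ≤ (l.length : ℝ) ^ 2 * E := by
  induction l with
  | nil =>
    rw [List.prod_nil, shift_one]
    simp
  | cons s l ih =>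
    have hs := hE s (hl s (by simp))
    have ih := ih fun t ht => hl t (by simp [ht])
    set u := f - shift s f with hu
    set v := f - shift l.prod f with hv
    have hdecomp : f - shift (s :: l).prod f = u + shift s v := by
      rw [List.prod_cons, shift_mul, hu, hv, map_sub]
      abel
    rw [hdecomp]
    simp only [map_add, LinearMap.add_apply, pairing_domLCongr, List.length_cons]
    rcases l.length.eq_zero_or_pos with h0 | hpos
    · rw [List.length_eq_zero_iff.1 h0] at hv ⊢
      have : v = 0 := by rw [hv, List.prod_nil, shift_one, sub_self]
      simpa [this] using hs
    · have hm : (0 : ℝ) < l.length := by exact_mod_cast hpos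
      set m : ℝ := (l.length : ℝ)
      have h := two_mul_pairing_le (m • u) (shift s v)
      simp only [map_smul, LinearMap.smul_apply, pairing_domLCongr, smul_eq_mul] at h
      have hc := pairing_comm (shift s v) u
      rw [hc]
      push_cast
      have : m * (pairing u u + pairing u (shift s v) + (pairing u (shift s v) + pairing v v)) ≤
          m * ((m + 1) ^ 2 * E) := by
        nlinarith [mul_le_mul_of_nonneg_left hs (by positivity : 0 ≤ m * (m + 1)),
          mul_le_mul_of_nonneg_left ih (by positivity : 0 ≤ m + 1)]
      exact le_of_mul_le_mul_left (by linarith) hm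

theorem sum_pairing_shift_le {f : H →₀ ℝ} (hf : ∀ x, 0 ≤ f x)
    (hmass : ∀ U : Finset H, ∑ x ∈ U, f x ≤ 1) (B : Finset H) :
    ∑ y ∈ B, pairing f (shift y f) ≤ 1 := by
  simp only [pairing_eq_sum subset_rfl, shift_apply]
  rw [sum_comm]
  refine le_trans (sum_le_sum fun x _ => ?_) (hmass f.support)
  rw [← mul_sum]
  have h := hmass (B.map ((Equiv.inv H).trans (Equiv.mulRight x)).toEmbedding)
  simp only [sum_map] at h
  exact mul_le_of_le_one_right (hf x) (by simpa using h)

/-- A Nash-type inequality along the random walk, obtained by averaging over a set `B` of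
products of at most `r` generators. -/
theorem energy_le_of_ball (h1 : 1 ∈ S) {r : ℕ} {B : Finset H} (hB : B.Nonempty)
    (hBr : ∀ y ∈ B, ∃ l : List H, l.length ≤ r ∧ (∀ s ∈ l, s ∈ S) ∧ l.prod = y) (n : ℕ) :
    energy S (MonoidHom.id H) n ≤ (#S : ℝ) ^ 2 * r ^ 2 *
      (energy S (MonoidHom.id H) n - energy S (MonoidHom.id H) (n + 1)) + 1 / #B := by
  have hS : S.Nonempty := ⟨1, h1⟩
  set f : H →₀ ℝ := (average S (MonoidHom.id H) ^ n) (Finsupp.single 1 1) with hfdef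
  have hδ (x : H) : (0 : ℝ) ≤ Finsupp.single (1 : H) (1 : ℝ) x := by
    classical
    rw [Finsupp.single_apply]; positivity
  have hf : ∀ x, 0 ≤ f x := average_pow_nonneg hδ n
  have hmass : ∀ U : Finset H, ∑ x ∈ U, f x ≤ 1 := by
    refine sum_average_pow_le zero_le_one (fun U => ?_) n
    classical
    simp only [Finsupp.single_apply, sum_ite_eq]
    split_ifs <;> norm_num
  have hen : energy S (MonoidHom.id H) n = pairing f f := rfl
  have hen' : energy S (MonoidHom.id H) (n + 1) =
      pairing (average S (MonoidHom.id H) f) (average S (MonoidHom.id H) f) := by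
    rw [energy, pow_succ', Module.End.mul_apply]
  have hN : (0 : ℝ) < #S := by exact_mod_cast hS.card_pos
  set E : ℝ := 2 * (#S : ℝ) ^ 2 *
    (energy S (MonoidHom.id H) n - energy S (MonoidHom.id H) (n + 1)) with hEdef
  have hE : ∀ s ∈ S, pairing (f - shift s f) (f - shift s f) ≤ E := by
    intro s hs
    rw [hEdef, hen, hen', pairing_self_sub_average hS, ← mul_assoc,
      mul_inv_cancel₀ (by positivity), one_mul]
    calc pairing (f - shift s f) (f - shift s f)
        = pairing (shift (1 : H) f - shift s f) (shift (1 : H) f - shift s f) := by rw [shift_one]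
      _ ≤ ∑ t ∈ S, pairing (shift (1 : H) f - shift t f) (shift (1 : H) f - shift t f) :=
          single_le_sum
            (f := fun t => pairing (shift (1 : H) f - shift t f) (shift (1 : H) f - shift t f))
            (fun _ _ => pairing_self_nonneg _) hs
      _ ≤ _ := single_le_sum (f := fun s => ∑ t ∈ S,
            pairing (shift s f - shift t f) (shift s f - shift t f))
            (fun _ _ => sum_nonneg fun _ _ => pairing_self_nonneg _) h1
  have hEnn : 0 ≤ E := (pairing_self_nonneg _).trans (hE 1 h1)
  have hpoint : ∀ y ∈ B, pairing f f ≤ r ^ 2 * E / 2 + pairing f (shift y f) := by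
    intro y hy
    obtain ⟨l, hlr, hlS, rfl⟩ := hBr y hy
    have h := pairing_sub_shift_prod_le hE l hlS
    rw [pairing_sub_self, pairing_domLCongr] at h
    have : (l.length : ℝ) ^ 2 * E ≤ r ^ 2 * E := by gcongr
    linarith
  have hB0 : (0 : ℝ) < #B := by exact_mod_cast hB.card_pos
  have hsum := sum_le_sum hpoint
  rw [sum_add_distrib, sum_const, sum_const, nsmul_eq_mul, nsmul_eq_mul] at hsum
  have := sum_pairing_shift_le hf hmass B
  rw [hen] at *
  rw [← sub_le_iff_le_add', le_div_iff₀ hB0]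
  have hEd : (#S : ℝ) ^ 2 * r ^ 2 * (pairing f f - energy S (MonoidHom.id H) (n + 1)) =
      r ^ 2 * E / 2 := by rw [hEdef]; ring
  rw [hEd]
  linarith

/-- Polynomial decay from a Nash-type inequality at every scale `r`. -/
theorem decay_of_nash {α : ℕ → ℝ} (hα : Antitone α) (hα0 : α 0 ≤ 1) {N D : ℕ} (hN : 1 ≤ N)
    {c : ℝ} (hc : 0 < c)
    (hnash : ∀ r : ℕ, 1 ≤ r → ∀ n,
      α n ≤ (N : ℝ) ^ 2 * r ^ 2 * (α n - α (n + 1)) + 1 / (c * r ^ D))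
    {r : ℕ} (hr : 1 ≤ r) :
    α ((4 * D * N ^ 2 + 1) * r ^ 2) ≤ max 1 (2 / c) / r ^ D := by
  set M := 4 * D * N ^ 2 + 1 with hM
  set K := max 1 (2 / c)
  induction r, hr using Nat.le_induction with
  | base =>
    rw [Nat.cast_one, one_pow, one_pow, div_one, mul_one]
    exact (hα (Nat.zero_le _)).trans (hα0.trans (le_max_left 1 (2 / c)))
  | succ r hr ih =>
    have hr0 : (0 : ℝ) < r := by exact_mod_cast hr
    have hN0 : (0 : ℝ) < N := by exact_mod_cast hN
    set R : ℝ := ((r + 1 : ℕ) : ℝ) with hR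
    have hRr : R = r + 1 := by rw [hR]; push_cast; ring
    have hR0 : 0 < R := by positivity
    by_cases hcase : α (M * (r + 1) ^ 2) ≤ 2 / (c * R ^ D)
    · refine hcase.trans ?_
      rw [← div_div]
      gcongr
      exact le_max_right _ _
    push Not at hcase
    have hstep (n : ℕ) (hn : n < M * (r + 1) ^ 2) :
        α (n + 1) ≤ Real.exp (-1 / (2 * N ^ 2 * R ^ 2)) * α n := by
      have h1 : 2 / (c * R ^ D) ≤ α n := hcase.le.trans (hα hn.le)
      have h2 := hnash (r + 1) (by lia) n
      rw [← hR] at h2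
      have hpos : 0 < α n := lt_of_lt_of_le (by positivity) h1
      have h3 : 1 / (c * R ^ D) ≤ α n / 2 := by
        have : 2 / (c * R ^ D) = 2 * (1 / (c * R ^ D)) := by ring
        linarith
      have h4 : α (n + 1) ≤ (-1 / (2 * N ^ 2 * R ^ 2) + 1) * α n := by
        have : α n / (2 * N ^ 2 * R ^ 2) ≤ α n - α (n + 1) := by
          rw [div_le_iff₀ (by positivity)]
          linarith
        have e : (-1 / (2 * (N : ℝ) ^ 2 * R ^ 2) + 1) * α n =
          α n - α n / (2 * N ^ 2 * R ^ 2) := by ring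
        linarith
      exact h4.trans (mul_le_mul_of_nonneg_right (Real.add_one_le_exp _) hpos.le)
    have hiter (j : ℕ) (hj : M * r ^ 2 + j ≤ M * (r + 1) ^ 2) :
        α (M * r ^ 2 + j) ≤ Real.exp (-1 / (2 * N ^ 2 * R ^ 2) * j) * α (M * r ^ 2) := by
      induction j with
      | zero => simp
      | succ j ihj =>
        refine (hstep (M * r ^ 2 + j) (by lia)).trans ?_
        refine (mul_le_mul_of_nonneg_left (ihj (by lia)) (Real.exp_pos _).le).trans ?_
        rw [← mul_assoc, ← Real.exp_add]
        apply le_of_eq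
        congr 2
        push_cast
        ring
    have heq : M * r ^ 2 + M * (2 * r + 1) = M * (r + 1) ^ 2 := by ring
    have h := hiter (M * (2 * r + 1)) heq.le
    rw [heq] at h
    have hexp : Real.exp (-1 / (2 * N ^ 2 * R ^ 2) * ((M * (2 * r + 1) : ℕ) : ℝ)) ≤
        (r / R) ^ D := by
      have h1 : Real.exp (-(1 / (r : ℝ))) ≤ r / R := by
        rw [Real.exp_neg, inv_le_comm₀ (Real.exp_pos _) (by positivity), inv_div]
        have := Real.add_one_le_exp (1 / (r : ℝ))
        have e : R / r = 1 / r + 1 := by rw [hRr]; field_simp; ring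
        linarith
      refine le_trans ?_ (pow_le_pow_left₀ (Real.exp_pos _).le h1 D)
      rw [← Real.exp_nat_mul, Real.exp_le_exp]
      have hMD : 4 * D * (N : ℝ) ^ 2 ≤ M := by rw [hM]; push_cast; linarith
      have : (D : ℝ) * (1 / r) ≤ 1 / (2 * N ^ 2 * R ^ 2) * (M * (2 * r + 1)) := by
        rw [mul_one_div, one_div_mul_eq_div, div_le_div_iff₀ hr0 (by positivity)]
        have hrR : R ^ 2 ≤ 2 * (2 * r + 1) * r := by
          have : (1 : ℝ) ≤ r := by exact_mod_cast hr
          rw [hRr]; nlinarith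
        calc (D : ℝ) * (2 * N ^ 2 * R ^ 2) = (2 * (D : ℝ) * N ^ 2) * R ^ 2 := by ring
          _ ≤ (2 * (D : ℝ) * N ^ 2) * (2 * (2 * r + 1) * r) := by gcongr
          _ = (4 * (D : ℝ) * N ^ 2) * ((2 * r + 1) * r) := by ring
          _ ≤ M * ((2 * r + 1) * r) := by gcongr
          _ = _ := by ring
      push_cast
      have e : -1 / (2 * (N : ℝ) ^ 2 * R ^ 2) * (M * (2 * r + 1)) =
        -(1 / (2 * N ^ 2 * R ^ 2) * (M * (2 * r + 1))) := by ring
      rw [e]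
      linarith
    have hnn : 0 ≤ α (M * r ^ 2) := by
      have : 0 < α (M * (r + 1) ^ 2) := lt_trans (by positivity) hcase
      exact this.le.trans (hα (by gcongr; lia))
    calc α (M * (r + 1) ^ 2) ≤ (r / R) ^ D * α (M * r ^ 2) :=
          h.trans (mul_le_mul_of_nonneg_right hexp hnn)
      _ ≤ (r / R) ^ D * (K / r ^ D) := by gcongr
      _ = K / R ^ D := by rw [div_pow]; field_simp

end UpperBound

section LowerBound
variable {H G : Type*} [Group H] [Group G] {S : Finset H} {π : H →* G}

/-- A lower bound for return probabilities from the test function `(2 * ρ - d)₊` on balls `V`. -/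
theorem le_energy_of_volume (hS : ∀ s ∈ S, s⁻¹ ∈ S) (h1 : 1 ∈ S) {d : G → ℕ}
    (hd : ∀ s ∈ S, ∀ x, d ((π s)⁻¹ * x) ≤ d x + 1) {V : ℕ → Finset G}
    (hV : ∀ r x, x ∈ V r ↔ d x ≤ r) {ρ m : ℕ} (hρ : 1 ≤ ρ) (hne : (V ρ).Nonempty)
    (hm : 4 * (m : ℝ) * #(V (3 * ρ)) ≤ (ρ : ℝ) ^ 2 * #(V ρ)) :
    1 / (2 * (#(V (2 * ρ)) : ℝ)) ≤ energy S π m := by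
  have hSne : S.Nonempty := ⟨1, h1⟩
  have hN : (0 : ℝ) < #S := by exact_mod_cast hSne.card_pos
  have hd' : ∀ s ∈ S, ∀ x, d x ≤ d ((π s)⁻¹ * x) + 1 := fun s hs x => by
    simpa using hd s⁻¹ (hS s hs) ((π s)⁻¹ * x)
  let f : G →₀ ℝ := Finsupp.onFinset (V (2 * ρ)) (fun x => ((2 * ρ - d x : ℕ) : ℝ)) fun x hx => by
    rw [hV]
    by_contra h
    exact hx (by rw [Nat.sub_eq_zero_of_le (by lia), Nat.cast_zero])
  have hf (x : G) : f x = ((2 * ρ - d x : ℕ) : ℝ) := rfl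
  have hf0 (x : G) : 0 ≤ f x := by rw [hf]; positivity
  have hsupp : f.support ⊆ V (2 * ρ) := Finsupp.support_onFinset_subset
  have hsub : V ρ ⊆ V (2 * ρ) := fun x hx => by
    rw [hV] at hx ⊢
    lia
  have hnorm : (ρ : ℝ) ^ 2 * #(V ρ) ≤ pairing f f := by
    rw [pairing_eq_sum hsupp]
    calc (ρ : ℝ) ^ 2 * #(V ρ) = ∑ x ∈ V ρ, (ρ : ℝ) * ρ := by
          rw [sum_const, nsmul_eq_mul]; ring
      _ ≤ ∑ x ∈ V ρ, f x * f x := by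
          refine sum_le_sum fun x hx => ?_
          have : (ρ : ℝ) ≤ f x := by
            rw [hV] at hx
            rw [hf]
            exact_mod_cast (by lia : ρ ≤ 2 * ρ - d x)
          exact mul_le_mul this this (by positivity) (hf0 x)
      _ ≤ _ := sum_le_sum_of_subset_of_nonneg hsub fun x _ _ => mul_self_nonneg _
  have hpos : 0 < pairing f f := by
    have : (0 : ℝ) < #(V ρ) := by exact_mod_cast hne.card_pos
    have : (0 : ℝ) < ρ := by exact_mod_cast hρ
    exact lt_of_lt_of_le (by positivity) hnorm
  have hgrad : ∀ s ∈ S, ∀ t ∈ S,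
      pairing (shift (π s) f - shift (π t) f) (shift (π s) f - shift (π t) f) ≤
        4 * #(V (3 * ρ)) := by
    intro s hs t ht
    have hsupp' : (shift (π s) f - shift (π t) f).support ⊆ V (3 * ρ) := by
      intro x hx
      rw [hV]
      by_contra h
      rw [Finsupp.mem_support_iff, Finsupp.sub_apply, shift_apply, shift_apply, hf, hf] at hx
      have h1 := hd' s hs x
      have h2 := hd' t ht x
      exact hx (by
        rw [Nat.sub_eq_zero_of_le (by lia), Nat.sub_eq_zero_of_le (by lia), sub_self])
    rw [pairing_eq_sum hsupp']
    refine (sum_le_sum (g := fun _ => (4 : ℝ)) fun x _ => ?_).trans (by simp [mul_comm])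
    rw [Finsupp.sub_apply, shift_apply, shift_apply, hf, hf]
    have h1 := hd' s hs x
    have h2 := hd' t ht x
    have h3 := hd s hs x
    have h4 := hd t ht x
    have h5 : ((2 * ρ - d ((π s)⁻¹ * x) : ℕ) : ℝ) ≤ ((2 * ρ - d ((π t)⁻¹ * x) : ℕ) : ℝ) + 2 := by
      exact_mod_cast (by lia)
    have h6 : ((2 * ρ - d ((π t)⁻¹ * x) : ℕ) : ℝ) ≤ ((2 * ρ - d ((π s)⁻¹ * x) : ℕ) : ℝ) + 2 := by
      exact_mod_cast (by lia)
    nlinarith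
  have henergy : pairing f f - pairing (average S π f) (average S π f) ≤ 2 * #(V (3 * ρ)) := by
    rw [pairing_self_sub_average hSne]
    calc (2 * (#S : ℝ) ^ 2)⁻¹ * ∑ s ∈ S, ∑ t ∈ S,
          pairing (shift (π s) f - shift (π t) f) (shift (π s) f - shift (π t) f)
        ≤ (2 * (#S : ℝ) ^ 2)⁻¹ * ∑ s ∈ S, ∑ t ∈ S, 4 * (#(V (3 * ρ)) : ℝ) := by
          gcongr with s hs t ht
          exact hgrad s hs t ht
      _ = 2 * #(V (3 * ρ)) := by
          simp only [sum_const, nsmul_eq_mul]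
          field_simp
          norm_num
  have hhalf : pairing f f / 2 ≤ pairing ((average S π ^ m) f) ((average S π ^ m) f) := by
    have h := pairing_self_sub_pow_le (π := π) hS f m
    have h' := mul_le_mul_of_nonneg_left henergy (Nat.cast_nonneg (α := ℝ) m)
    linarith
  have hup := pairing_average_pow_le (S := S) (π := π) hf0 m
  have hen0 : 0 ≤ energy S π m := pairing_self_nonneg _
  have hcs : (∑ x ∈ f.support, f x) ^ 2 ≤ #(V (2 * ρ)) * pairing f f := by
    rw [pairing_eq_sum subset_rfl]
    refine sq_sum_le_card_mul_sum_sq.trans ?_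
    simp only [← sq]
    gcongr
  have hV2 : (0 : ℝ) < #(V (2 * ρ)) := by exact_mod_cast (hne.mono hsub).card_pos
  rw [div_le_iff₀ (by positivity)]
  refine le_of_mul_le_mul_right ?_ hpos
  have := mul_le_mul_of_nonneg_right hcs hen0
  linarith

end LowerBound

section WordLength
variable {H : Type*} [Group H] {d' : ℕ} {e : Fin d' → H}

theorem wordLength_prod_le {l : List H} (hl : ∀ x ∈ l, ∃ i, x = e i ∨ x = (e i)⁻¹) :
    wordLength e l.prod ≤ l.length :=
  Nat.sInf_le ⟨l, rfl, hl, rfl⟩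

theorem exists_list_length_eq_wordLength (hgen : Subgroup.closure (Set.range e) = ⊤) (g : H) :
    ∃ l : List H, l.length = wordLength e g ∧
      (∀ x ∈ l, ∃ i, x = e i ∨ x = (e i)⁻¹) ∧ l.prod = g := by
  have hne : { k | ∃ l : List H, l.length = k ∧
      (∀ x ∈ l, ∃ i, x = e i ∨ x = (e i)⁻¹) ∧ l.prod = g }.Nonempty := by
    have hg : g ∈ (Subgroup.closure (Set.range e)).toSubmonoid := hgen ▸ Subgroup.mem_top g
    rw [Subgroup.closure_toSubmonoid] at hg
    obtain ⟨l, hl, hprod⟩ := Submonoid.exists_list_of_mem_closure hg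
    refine ⟨l.length, l, rfl, fun x hx => ?_, hprod⟩
    rcases hl x hx with ⟨i, hi⟩ | ⟨i, hi⟩
    · exact ⟨i, Or.inl hi.symm⟩
    · exact ⟨i, Or.inr (by rw [hi, inv_inv])⟩
  exact Nat.sInf_mem hne

theorem wordLength_one : wordLength e 1 = 0 :=
  Nat.le_zero.1 (wordLength_prod_le (l := []) (by simp))

theorem wordLength_mul_le (hgen : Subgroup.closure (Set.range e) = ⊤) (g h : H) :
    wordLength e (g * h) ≤ wordLength e g + wordLength e h := by
  obtain ⟨l, hl, hle, hg⟩ := exists_list_length_eq_wordLength hgen g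
  obtain ⟨l', hl', hle', hh⟩ := exists_list_length_eq_wordLength hgen h
  have := wordLength_prod_le (e := e) (l := l ++ l') fun x hx =>
    (List.mem_append.1 hx).elim (hle x) (hle' x)
  rwa [List.prod_append, List.length_append, hg, hh, hl, hl'] at this

theorem wordLength_inv_le (hgen : Subgroup.closure (Set.range e) = ⊤) (g : H) :
    wordLength e g⁻¹ ≤ wordLength e g := by
  obtain ⟨l, hl, hle, hg⟩ := exists_list_length_eq_wordLength hgen g
  have := wordLength_prod_le (e := e) (l := (l.map (·⁻¹)).reverse) fun x hx => by
    obtain ⟨y, hy, rfl⟩ := List.mem_map.1 (List.mem_reverse.1 hx)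
    obtain ⟨i, rfl | rfl⟩ := hle y hy
    · exact ⟨i, Or.inr rfl⟩
    · exact ⟨i, Or.inl (inv_inv _)⟩
  rwa [← List.prod_inv_reverse, List.length_reverse, List.length_map, hg, hl] at this

variable (e) in
open scoped Classical in
/-- The support of the lazy simple random walk measure. -/
noncomputable def lazyGenerators : Finset H :=
  insert 1 (univ.image e ∪ univ.image fun i => (e i)⁻¹)

theorem mem_lazyGenerators {g : H} :
    g ∈ lazyGenerators e ↔ g = 1 ∨ ∃ i, g = e i ∨ g = (e i)⁻¹ := by
  simp [lazyGenerators, exists_or, eq_comm]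

theorem one_mem_lazyGenerators : (1 : H) ∈ lazyGenerators e :=
  mem_lazyGenerators.2 (Or.inl rfl)

theorem inv_mem_lazyGenerators : ∀ s ∈ lazyGenerators e, s⁻¹ ∈ lazyGenerators e := by
  intro s hs
  rw [mem_lazyGenerators] at hs ⊢
  rcases hs with rfl | ⟨i, rfl | rfl⟩
  · simp
  · exact Or.inr ⟨i, Or.inr rfl⟩
  · exact Or.inr ⟨i, Or.inl (inv_inv _)⟩

theorem wordLength_le_one {s : H} (hs : s ∈ lazyGenerators e) : wordLength e s ≤ 1 := by
  rcases mem_lazyGenerators.1 hs with rfl | h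
  · simp [wordLength_one]
  · simpa using wordLength_prod_le (e := e) (l := [s]) (by simpa using h)

theorem convPow_lazySRW (n : ℕ) (x : H) :
    convPow (lazySRW e) n x = ((#(lazyGenerators e) : ℝ) / (2 * d' + 1)) ^ n *
      (average (lazyGenerators e) (MonoidHom.id H) ^ n) (Finsupp.single 1 1) x := by
  classical
  have hN : (#(lazyGenerators e) : ℝ) ≠ 0 := by
    exact_mod_cast card_ne_zero_of_mem (one_mem_lazyGenerators (e := e))
  induction n generalizing x with
  | zero => simp [convPow, Finsupp.single_apply, eq_comm]
  | succ n ih =>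
    rw [pow_succ' (average _ _), Module.End.mul_apply, average_apply]
    simp only [convPow, conv]
    rw [finsum_eq_sum_of_support_subset (s := lazyGenerators e)]
    · rw [mul_sum, mul_sum]
      refine sum_congr rfl fun s hs => ?_
      rw [ih, lazySRW, if_pos (mem_lazyGenerators.1 hs), MonoidHom.id_apply, pow_succ]
      field_simp
    · intro y hy
      rw [mem_coe, mem_lazyGenerators]
      by_contra h
      exact hy (by simp [lazySRW, h])

/-- The distance from the identity coset in the quotient by a subgroup. -/
noncomputable def cosetLength (e : Fin d' → H) (Z : Subgroup H) (x : H ⧸ Z) : ℕ :=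
  sInf {n | ∃ h : H, (h : H ⧸ Z) = x ∧ wordLength e h = n}

theorem cosetLength_mk_le {Z : Subgroup H} (h : H) :
    cosetLength e Z (h : H ⧸ Z) ≤ wordLength e h :=
  Nat.sInf_le ⟨h, rfl, rfl⟩

theorem exists_wordLength_eq_cosetLength {Z : Subgroup H} (x : H ⧸ Z) :
    ∃ h : H, (h : H ⧸ Z) = x ∧ wordLength e h = cosetLength e Z x := by
  have hne : {n | ∃ h : H, (h : H ⧸ Z) = x ∧ wordLength e h = n}.Nonempty := by
    obtain ⟨h, rfl⟩ := QuotientGroup.mk_surjective x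
    exact ⟨_, h, rfl, rfl⟩
  exact Nat.sInf_mem hne

theorem cosetLength_mul_le (hgen : Subgroup.closure (Set.range e) = ⊤) {Z : Subgroup H} [Z.Normal]
    {s : H} (hs : s ∈ lazyGenerators e) (x : H ⧸ Z) :
    cosetLength e Z ((QuotientGroup.mk' Z s)⁻¹ * x) ≤ cosetLength e Z x + 1 := by
  obtain ⟨h, rfl, hh⟩ := exists_wordLength_eq_cosetLength (e := e) x
  rw [← hh]
  refine (cosetLength_mk_le (s⁻¹ * h)).trans ((wordLength_mul_le hgen _ _).trans ?_)
  have := wordLength_le_one (inv_mem_lazyGenerators s hs)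
  lia

end WordLength

section Volume
variable {H : Type*} [Group H] {d' : ℕ} {e : Fin d' → H} {z : H}

theorem mk_mul_zpow (h : H) (l : ℤ) :
    ((h * z ^ l : H) : H ⧸ Subgroup.zpowers z) = h :=
  (QuotientGroup.eq.2 (by simp [Subgroup.zpow_mem_zpowers])).symm

theorem card_coset_ball_mul_le (hgen : Subgroup.closure (Set.range e) = ⊤)
    (hz : Function.Injective fun l : ℤ => z ^ l) {B : Finset H}
    {V : Finset (H ⧸ Subgroup.zpowers z)} {L : Finset ℤ} {r : ℕ}
    (hB : ∀ h, wordLength e h ≤ 2 * r → h ∈ B)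
    (hV : ∀ x ∈ V, cosetLength e (Subgroup.zpowers z) x ≤ r)
    (hL : ∀ l ∈ L, wordLength e (z ^ l) ≤ r) : #V * #L ≤ #B := by
  choose σ hσ hσ' using exists_wordLength_eq_cosetLength (e := e) (Z := Subgroup.zpowers z)
  rw [← card_product]
  refine card_le_card_of_injOn (fun p => σ p.1 * z ^ p.2) ?_ ?_
  · rintro ⟨x, l⟩ hp
    obtain ⟨hx, hl⟩ := mem_product.1 (mem_coe.1 hp)
    refine mem_coe.2 (hB _ ((wordLength_mul_le hgen _ _).trans ?_))
    have h1 := hV x hx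
    have h2 := hL l hl
    rw [← hσ'] at h1
    dsimp only
    lia
  · rintro ⟨x, l⟩ _ ⟨y, l'⟩ _ h
    dsimp only at h
    have hxy : x = y := by
      rw [← hσ x, ← hσ y, ← mk_mul_zpow (σ x) l, h, mk_mul_zpow]
    subst hxy
    rw [hz (mul_left_cancel h)]

theorem card_ball_le (hgen : Subgroup.closure (Set.range e) = ⊤) {B : Finset H}
    {V : Finset (H ⧸ Subgroup.zpowers z)} {L : Finset ℤ} {r : ℕ}
    (hB : ∀ h ∈ B, wordLength e h ≤ r)
    (hV : ∀ x, cosetLength e (Subgroup.zpowers z) x ≤ r → x ∈ V)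
    (hL : ∀ l : ℤ, wordLength e (z ^ l) ≤ 2 * r → l ∈ L) : #B ≤ #V * #L := by
  choose σ hσ hσ' using exists_wordLength_eq_cosetLength (e := e) (Z := Subgroup.zpowers z)
  have hex (h : H) : ∃ l : ℤ, z ^ l = (σ (h : H ⧸ Subgroup.zpowers z))⁻¹ * h :=
    Subgroup.mem_zpowers_iff.1 (QuotientGroup.eq.1 (hσ _))
  choose τ hτ using hex
  rw [← card_product]
  refine card_le_card_of_injOn (fun h => ((h : H ⧸ Subgroup.zpowers z), τ h)) ?_ ?_
  · intro h hh
    have h0 := hB h hh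
    have h1 := (cosetLength_mk_le (e := e) (Z := Subgroup.zpowers z) h).trans h0
    refine mem_coe.2 (mem_product.2 ⟨hV _ h1, hL _ ?_⟩)
    rw [hτ]
    refine (wordLength_mul_le hgen _ _).trans ?_
    have h2 := wordLength_inv_le hgen (σ (h : H ⧸ Subgroup.zpowers z))
    rw [hσ'] at h2
    lia
  · intro h _ h' _ heq
    obtain ⟨h1, h2⟩ := Prod.mk.inj heq
    have h3 := hτ h
    rw [h2, hτ h', h1] at h3
    exact (mul_left_cancel h3).symm

end Volume

section ReturnProbability
variable {H G : Type*} [Group H] [Group G] {S : Finset H} {π : H →* G}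

theorem single_one_nonneg (x : G) : 0 ≤ Finsupp.single (1 : G) (1 : ℝ) x := by
  classical
  rw [Finsupp.single_apply]
  positivity

theorem average_pow_le_energy (hS : ∀ s ∈ S, s⁻¹ ∈ S) (h1 : 1 ∈ S) (n : ℕ) (x : G) :
    (average S π ^ n) (Finsupp.single 1 1) x ≤ energy S π (n / 2) := by
  obtain ⟨m, rfl | rfl⟩ := n.even_or_odd'
  · rw [Nat.mul_div_cancel_left m two_pos]
    exact average_pow_two_mul_le hS m x
  · rw [show (2 * m + 1) / 2 = m by lia, pow_succ', Module.End.mul_apply]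
    exact average_le_of_le ⟨1, h1⟩ (average_pow_two_mul_le hS m) x

theorem inv_mul_energy_le (hS : ∀ s ∈ S, s⁻¹ ∈ S) (h1 : 1 ∈ S) (n : ℕ) :
    (#S : ℝ)⁻¹ * energy S π (n / 2) ≤ (average S π ^ n) (Finsupp.single 1 1) 1 := by
  obtain ⟨m, rfl | rfl⟩ := n.even_or_odd'
  · rw [Nat.mul_div_cancel_left m two_pos, average_pow_two_mul_one hS]
    refine mul_le_of_le_one_left (pairing_self_nonneg _) (inv_le_one_of_one_le₀ ?_)
    exact_mod_cast card_pos.2 ⟨1, h1⟩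
  · rw [show (2 * m + 1) / 2 = m by lia, pow_succ', Module.End.mul_apply,
      ← average_pow_two_mul_one hS]
    exact inv_mul_le_average h1 (average_pow_nonneg single_one_nonneg _) 1

theorem energy_antitone (hS : S.Nonempty) : Antitone (energy S π) :=
  antitone_nat_of_succ_le fun n => by
    rw [energy, pow_succ', Module.End.mul_apply]
    exact pairing_average_le hS _

theorem energy_zero : energy S π 0 = 1 := by
  rw [energy, pow_zero, Module.End.one_apply, pairing_single_right, Finsupp.single_eq_same]

theorem tsum_zpow_eq_mapDomain {z : H} (hz : Function.Injective fun l : ℤ => z ^ l)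
    [(Subgroup.zpowers z).Normal] (f : H →₀ ℝ) :
    ∑' l : ℤ, f (z ^ l) =
      Finsupp.mapDomain (QuotientGroup.mk' (Subgroup.zpowers z)) f 1 := by
  classical
  have hmem (x : H) : QuotientGroup.mk' (Subgroup.zpowers z) x = 1 ↔
      x ∈ Set.range fun l : ℤ => z ^ l := by
    rw [QuotientGroup.mk'_apply, QuotientGroup.eq_one_iff, Subgroup.mem_zpowers_iff, Set.mem_range]
  set F : H → ℝ := fun x => if QuotientGroup.mk' (Subgroup.zpowers z) x = 1 then f x else 0
    with hF
  have h1 : ∑' l : ℤ, f (z ^ l) = ∑' l : ℤ, F (z ^ l) :=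
    tsum_congr fun l => by rw [hF]; exact (if_pos ((hmem _).2 ⟨l, rfl⟩)).symm
  have h2 : Function.support F ⊆ Set.range fun l : ℤ => z ^ l := by
    intro x hx
    rw [← hmem]
    by_contra h
    exact hx (if_neg h)
  rw [h1, hz.tsum_eq h2, tsum_eq_sum (s := f.support), Finsupp.mapDomain, Finsupp.sum_apply,
    Finsupp.sum]
  · exact sum_congr rfl fun x _ => (Finsupp.single_apply).symm
  · intro x hx
    simp [hF, Finsupp.notMem_support_iff.1 hx]

end ReturnProbability

theorem mul_sub_le_tsum_abs_mul {q : ℤ → ℝ} (hfin : (Function.support q).Finite)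
    (hq : ∀ l, 0 ≤ q l) {a T : ℝ} (ha : ∀ l, q l ≤ a) (hT : 0 ≤ T) :
    T * (∑' l, q l - (2 * T + 1) * a) ≤ ∑' l : ℤ, ((|l| : ℤ) : ℝ) * q l := by
  set t := ⌊T⌋₊
  set U := Icc (-(t : ℤ)) t
  set W := hfin.toFinset ∪ U
  have hqW : ∀ l ∉ W, q l = 0 := fun l hl => by
    by_contra h
    exact hl (mem_union_left _ (hfin.mem_toFinset.2 h))
  have ha0 : 0 ≤ a := (hq 0).trans (ha 0)
  rw [tsum_eq_sum hqW, tsum_eq_sum (s := W) fun l hl => by rw [hqW l hl, mul_zero]]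
  have hcard : (#U : ℝ) ≤ 2 * T + 1 := by
    have h := Nat.floor_le hT
    have : #U = 2 * t + 1 := by
      rw [Int.card_Icc]
      lia
    rw [this]
    push_cast
    linarith
  have hpoint : ∀ l ∈ W, T * q l ≤ ((|l| : ℤ) : ℝ) * q l + if l ∈ U then T * a else 0 := by
    intro l _
    split_ifs with h
    · have h1 := mul_le_mul_of_nonneg_left (ha l) hT
      have h2 : 0 ≤ ((|l| : ℤ) : ℝ) * q l := mul_nonneg (by positivity) (hq l)
      linarith
    · rw [add_zero]
      refine mul_le_mul_of_nonneg_right ?_ (hq l)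
      have h1 : ((t : ℤ) + 1) ≤ |l| := by
        by_contra h'
        exact h (mem_Icc.2 (abs_le.1 (by lia)))
      have h2 : ((t : ℝ) + 1) ≤ ((|l| : ℤ) : ℝ) := by exact_mod_cast h1
      linarith [Nat.lt_floor_add_one T]
  have hsum := sum_le_sum hpoint
  rw [sum_add_distrib, ← mul_sum, sum_ite_mem, inter_eq_right.2 subset_union_right, sum_const,
    nsmul_eq_mul] at hsum
  have := mul_le_mul_of_nonneg_right hcard (mul_nonneg hT ha0)
  linarith

section PolynomialGrowth
variable {H : Type*} [Group H] {d' : ℕ} {e : Fin d' → H} {z : H}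

theorem exists_coset_volume_bounds (hgen : Subgroup.closure (Set.range e) = ⊤)
    (hz : Function.Injective fun l : ℤ => z ^ l) {k c C : ℝ} (hk : 0 < k) (hc : 0 < c)
    (hC : 0 < C)
    (hdist : ∀ l : ℤ, l ≠ 0 →
      c * ((|l| : ℤ) : ℝ) ^ (1 / k) ≤ (wordLength e (z ^ l) : ℝ) ∧
      (wordLength e (z ^ l) : ℝ) ≤ C * ((|l| : ℤ) : ℝ) ^ (1 / k))
    {D : ℕ} {c₁ c₂ : ℝ} (hc₁ : 0 < c₁) (hc₂ : 0 < c₂) {B : ℕ → Finset H}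
    (hB : ∀ r h, h ∈ B r ↔ wordLength e h ≤ r)
    (hcard : ∀ r : ℕ, 1 ≤ r → c₁ * (r : ℝ) ^ D ≤ #(B r) ∧ (#(B r) : ℝ) ≤ c₂ * (r : ℝ) ^ D)
    {V : ℕ → Finset (H ⧸ Subgroup.zpowers z)}
    (hV : ∀ r x, x ∈ V r ↔ cosetLength e (Subgroup.zpowers z) x ≤ r) :
    ∃ A₁ A₂ : ℝ, 0 < A₁ ∧ 0 < A₂ ∧ ∀ r : ℕ, 1 ≤ r →
      A₁ * (r : ℝ) ^ D ≤ #(V r) * (r : ℝ) ^ k ∧ #(V r) * (r : ℝ) ^ k ≤ A₂ * (r : ℝ) ^ D := by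
  refine ⟨c₁ / (2 * (2 / c) ^ k + 1), c₂ * 2 ^ D * C ^ k, by positivity, by positivity,
    fun r hr => ⟨?_, ?_⟩⟩
  · have hr1 : (1 : ℝ) ≤ r := by exact_mod_cast hr
    have hrk : 1 ≤ (r : ℝ) ^ k := Real.one_le_rpow hr1 hk.le
    set y : ℝ := (2 / c * r) ^ k with hy
    have hyr : y = (2 / c) ^ k * r ^ k := Real.mul_rpow (by positivity) (by positivity)
    have h := card_ball_le (z := z) (r := r) (L := Icc (-(⌊y⌋₊ : ℤ)) ⌊y⌋₊) hgen
      (fun h hh => (hB r h).1 hh) (fun x hx => (hV r x).2 hx) (fun l hl => by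
        rw [mem_Icc, ← abs_le]
        rcases eq_or_ne l 0 with rfl | hl0
        · simp
        have h1 := (hdist l hl0).1
        have h2 : (wordLength e (z ^ l) : ℝ) ≤ 2 * r := by exact_mod_cast hl
        have h3 : ((|l| : ℤ) : ℝ) ^ k⁻¹ ≤ 2 / c * r := by
          rw [div_mul_eq_mul_div, le_div_iff₀ hc, ← one_div]
          linarith
        rw [Real.rpow_inv_le_iff_of_pos (by positivity) (by positivity) hk] at h3
        rw [← Nat.cast_natAbs] at h3
        rw [Int.abs_eq_natAbs]
        exact Int.ofNat_le.2 (Nat.le_floor h3))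
    have hcardL : #(Icc (-(⌊y⌋₊ : ℤ)) ⌊y⌋₊) = 2 * ⌊y⌋₊ + 1 := by
      rw [Int.card_Icc]
      lia
    rw [hcardL] at h
    have h' : (#(B r) : ℝ) ≤ #(V r) * (2 * ⌊y⌋₊ + 1) := by exact_mod_cast h
    have hfl : (⌊y⌋₊ : ℝ) ≤ y := Nat.floor_le (by positivity)
    rw [div_mul_eq_mul_div, div_le_iff₀ (by positivity)]
    calc c₁ * (r : ℝ) ^ D ≤ #(V r) * (2 * ⌊y⌋₊ + 1) := (hcard r hr).1.trans h'
      _ ≤ #(V r) * (2 * y + r ^ k) := by gcongr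
      _ = _ := by rw [hyr]; ring
  · set y : ℝ := (r / C) ^ k with hy
    have h := card_coset_ball_mul_le (z := z) (r := r) (L := Icc (0 : ℤ) ⌊y⌋₊) hgen hz
      (fun h hh => (hB (2 * r) h).2 hh) (fun x hx => (hV r x).1 hx) (fun l hl => by
        rw [mem_Icc] at hl
        rcases eq_or_ne l 0 with rfl | hl0
        · simp [wordLength_one]
        have h1 := (hdist l hl0).2
        have h3 : ((|l| : ℤ) : ℝ) ≤ y := by
          rw [abs_of_nonneg hl.1]
          refine le_trans ?_ (Nat.floor_le (by positivity : 0 ≤ y))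
          exact_mod_cast hl.2
        rw [hy, ← Real.rpow_inv_le_iff_of_pos (by positivity) (by positivity) hk,
          le_div_iff₀ hC, ← one_div] at h3
        exact_mod_cast (by linarith : (wordLength e (z ^ l) : ℝ) ≤ r))
    have hcardL : #(Icc (0 : ℤ) ⌊y⌋₊) = ⌊y⌋₊ + 1 := by
      rw [Int.card_Icc]
      lia
    rw [hcardL] at h
    have h' : (#(V r) : ℝ) * (⌊y⌋₊ + 1) ≤ #(B (2 * r)) := by exact_mod_cast h
    have hB2 := (hcard (2 * r) (by lia)).2
    have hfl := (Nat.lt_floor_add_one y).le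
    have h2 : (#(V r) : ℝ) * y ≤ c₂ * ((2 * r : ℕ) : ℝ) ^ D :=
      (mul_le_mul_of_nonneg_left hfl (by positivity)).trans (h'.trans hB2)
    rw [hy, Real.div_rpow (by positivity) hC.le, mul_div_assoc', div_le_iff₀ (by positivity)] at h2
    refine h2.trans (le_of_eq ?_)
    push_cast
    ring

theorem exists_energy_le (hgen : Subgroup.closure (Set.range e) = ⊤) {D : ℕ} {c₁ : ℝ}
    (hc₁ : 0 < c₁) {B : ℕ → Finset H} (hB : ∀ r h, h ∈ B r ↔ wordLength e h ≤ r)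
    (hcard : ∀ r : ℕ, 1 ≤ r → c₁ * (r : ℝ) ^ D ≤ #(B r)) :
    ∃ K : ℝ, 0 < K ∧ ∃ M : ℕ, 1 ≤ M ∧ ∀ r m : ℕ, 1 ≤ r → M * r ^ 2 ≤ m →
      energy (lazyGenerators e) (MonoidHom.id H) m ≤ K / (r : ℝ) ^ D := by
  have h1 : (1 : H) ∈ lazyGenerators e := one_mem_lazyGenerators
  refine ⟨max 1 (2 / c₁), by positivity, 4 * D * #(lazyGenerators e) ^ 2 + 1, by lia,
    fun r m hr hm => (energy_antitone ⟨1, h1⟩ hm).trans ?_⟩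
  refine decay_of_nash (energy_antitone ⟨1, h1⟩) energy_zero.le (card_pos.2 ⟨1, h1⟩) hc₁
    (fun r hr n => ?_) hr
  have hne : (B r).Nonempty := ⟨1, (hB r 1).2 (by simp [wordLength_one])⟩
  refine (energy_le_of_ball h1 hne (r := r) (fun y hy => ?_) n).trans ?_
  · obtain ⟨l, hl, hle, hprod⟩ := exists_list_length_eq_wordLength hgen y
    exact ⟨l, hl.trans_le ((hB r y).1 hy), fun s hs => mem_lazyGenerators.2 (Or.inr (hle s hs)),
      hprod⟩
  · have : (0 : ℝ) < r := by exact_mod_cast hr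
    gcongr
    exact hcard r hr

theorem exists_le_energy (hgen : Subgroup.closure (Set.range e) = ⊤)
    [(Subgroup.zpowers z).Normal] {k : ℝ} (hk : 0 < k) {D : ℕ}
    {V : ℕ → Finset (H ⧸ Subgroup.zpowers z)}
    (hV : ∀ r x, x ∈ V r ↔ cosetLength e (Subgroup.zpowers z) x ≤ r) {A₁ A₂ : ℝ} (hA₁ : 0 < A₁)
    (hA₂ : 0 < A₂)
    (hvol : ∀ r : ℕ, 1 ≤ r →
      A₁ * (r : ℝ) ^ D ≤ #(V r) * (r : ℝ) ^ k ∧ #(V r) * (r : ℝ) ^ k ≤ A₂ * (r : ℝ) ^ D)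
    (M : ℕ) :
    ∃ b : ℝ, 0 < b ∧ ∀ r m : ℕ, 1 ≤ r → m ≤ M * r ^ 2 →
      b * (r : ℝ) ^ k / (r : ℝ) ^ D ≤
        energy (lazyGenerators e) (QuotientGroup.mk' (Subgroup.zpowers z)) m := by
  obtain ⟨A, hA⟩ := exists_nat_ge (4 * A₂ * 3 ^ D / A₁)
  set β := A * M + 1 with hβ
  have hβ0 : (0 : ℝ) < β := by positivity
  refine ⟨(2 * β) ^ k / (2 * A₂ * (2 * β) ^ D), by positivity, fun r m hr hm => ?_⟩
  have hr0 : (0 : ℝ) < r := by exact_mod_cast hr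
  set ρ := β * r with hρ
  have hρ1 : 1 ≤ ρ := Nat.mul_pos (by lia) hr
  have hρ0 : (0 : ℝ) < ρ := by exact_mod_cast hρ1
  have hVpos (s : ℕ) (hs : 1 ≤ s) : (0 : ℝ) < #(V s) := by
    have hs0 : (0 : ℝ) < s := by exact_mod_cast hs
    have h : 0 < #(V s) * (s : ℝ) ^ k := lt_of_lt_of_le (by positivity) (hvol s hs).1
    exact pos_of_mul_pos_left h (by positivity)
  have hdoubling : 4 * (#(V (3 * ρ)) : ℝ) ≤ A * #(V ρ) := by
    have h1 := (hvol ρ hρ1).1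
    have h2 := (hvol (3 * ρ) (by lia)).2
    have h3 : (ρ : ℝ) ^ k ≤ ((3 * ρ : ℕ) : ℝ) ^ k := by
      gcongr
      lia
    rw [div_le_iff₀ hA₁] at hA
    refine le_of_mul_le_mul_right ?_ (by positivity : 0 < (ρ : ℝ) ^ k)
    calc 4 * (#(V (3 * ρ)) : ℝ) * (ρ : ℝ) ^ k
        ≤ 4 * #(V (3 * ρ)) * ((3 * ρ : ℕ) : ℝ) ^ k := by gcongr
      _ ≤ 4 * (A₂ * ((3 * ρ : ℕ) : ℝ) ^ D) := by linarith
      _ = 4 * A₂ * 3 ^ D * (ρ : ℝ) ^ D := by push_cast; ring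
      _ ≤ A * A₁ * (ρ : ℝ) ^ D := by gcongr
      _ = A * (A₁ * (ρ : ℝ) ^ D) := by ring
      _ ≤ A * (#(V ρ) * (ρ : ℝ) ^ k) := by gcongr
      _ = _ := by ring
  have hAm : A * m ≤ ρ ^ 2 :=
    calc A * m ≤ A * (M * r ^ 2) := by gcongr
      _ = A * M * r ^ 2 := by ring
      _ ≤ β ^ 2 * r ^ 2 := by gcongr; rw [hβ]; nlinarith
      _ = ρ ^ 2 := by rw [hρ]; ring
  have hm' : 4 * (m : ℝ) * #(V (3 * ρ)) ≤ (ρ : ℝ) ^ 2 * #(V ρ) := by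
    have h1 := mul_le_mul_of_nonneg_left hdoubling (Nat.cast_nonneg (α := ℝ) m)
    have h2 : (A : ℝ) * m ≤ (ρ : ℝ) ^ 2 := by exact_mod_cast hAm
    have h3 := mul_le_mul_of_nonneg_right h2 (hVpos ρ hρ1).le
    linarith
  refine le_trans ?_ (le_energy_of_volume inv_mem_lazyGenerators one_mem_lazyGenerators
    (fun s hs x => cosetLength_mul_le hgen hs x) hV hρ1
    (card_pos.1 (by exact_mod_cast hVpos ρ hρ1)) hm')
  have h2 := (hvol (2 * ρ) (by lia)).2
  have h2pos := hVpos (2 * ρ) (by lia)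
  have hcast : ((2 * ρ : ℕ) : ℝ) = 2 * β * r := by rw [hρ]; push_cast; ring
  rw [hcast, Real.mul_rpow (by positivity) hr0.le, mul_pow] at h2
  rw [div_mul_eq_mul_div, div_div, div_le_div_iff₀ (by positivity) (by positivity)]
  linarith

end PolynomialGrowth

theorem conditional_expected_power_lower_bound (H : Type*) [Group H]
    (hnilp : Group.IsNilpotent H)
    {d' : ℕ} (e : Fin d' → H)
    (hgen : Subgroup.closure (Set.range e) = ⊤)
    (D : ℕ)
    (hgrowth : ∃ c₁ c₂ : ℝ, 0 < c₁ ∧ 0 < c₂ ∧ ∀ ρ : ℕ, 1 ≤ ρ →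
      c₁ * (ρ : ℝ) ^ D ≤ (Nat.card {h : H | wordLength e h ≤ ρ} : ℝ) ∧
      (Nat.card {h : H | wordLength e h ≤ ρ} : ℝ) ≤ c₂ * (ρ : ℝ) ^ D)
    (z : H) (hz : z ∈ Subgroup.center H) (hzord : ¬ IsOfFinOrder z)
    (k : ℝ) (hk : 2 ≤ k)
    (c C : ℝ) (hc : 0 < c) (hcC : c ≤ C)
    (hdist : ∀ l : ℤ, l ≠ 0 →
      c * ((|l| : ℤ) : ℝ) ^ (1 / k) ≤ (wordLength e (z ^ l) : ℝ) ∧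
      (wordLength e (z ^ l) : ℝ) ≤ C * ((|l| : ℤ) : ℝ) ^ (1 / k)) :
    ∃ c₃ : ℝ, 0 < c₃ ∧ ∃ N₀ : ℕ, ∀ n : ℕ, N₀ ≤ n →
      c₃ * (n : ℝ) ^ (k / 2) ≤
        (∑' l : ℤ, ((|l| : ℤ) : ℝ) * convPow (lazySRW e) n (z ^ l)) /
          (∑' l : ℤ, convPow (lazySRW e) n (z ^ l)) := by
  classical
  obtain ⟨c₁, c₂, hc₁, hc₂, hgrowth⟩ := hgrowth
  have hk0 : 0 < k := by linarith
  have hinj : Function.Injective fun l : ℤ => z ^ l := injective_zpow_iff_not_isOfFinOrder.2 hzord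
  have : (Subgroup.zpowers z).Normal := by
    refine ⟨fun x hx g => ?_⟩
    rw [Subgroup.mem_center_iff.1 (Subgroup.zpowers_le.2 hz hx) g, mul_inv_cancel_right]
    exact hx
  have hfin (r : ℕ) : {h : H | wordLength e h ≤ r}.Finite := by
    have hpos : (0 : ℝ) < (Nat.card {h : H | wordLength e h ≤ r + 1} : ℝ) :=
      lt_of_lt_of_le (by positivity) (hgrowth (r + 1) (by lia)).1
    have : Finite {h : H | wordLength e h ≤ r + 1} :=
      Nat.finite_of_card_ne_zero (by exact_mod_cast hpos.ne')
    exact (Set.toFinite {h : H | wordLength e h ≤ r + 1}).subset fun h hh => Nat.le_succ_of_le hh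
  set B : ℕ → Finset H := fun r => (hfin r).toFinset
  have hB (r h) : h ∈ B r ↔ wordLength e h ≤ r := (hfin r).mem_toFinset
  have hcard (r : ℕ) (hr : 1 ≤ r) :
      c₁ * (r : ℝ) ^ D ≤ #(B r) ∧ (#(B r) : ℝ) ≤ c₂ * (r : ℝ) ^ D := by
    rw [← Set.ncard_eq_toFinset_card _ (hfin r)]
    exact hgrowth r hr
  set V : ℕ → Finset (H ⧸ Subgroup.zpowers z) := fun r => (B r).image (↑)
  have hV (r x) : x ∈ V r ↔ cosetLength e (Subgroup.zpowers z) x ≤ r := by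
    constructor
    · intro hx
      obtain ⟨h, hh, rfl⟩ := mem_image.1 hx
      exact (cosetLength_mk_le h).trans ((hB r h).1 hh)
    · intro hx
      obtain ⟨h, rfl, hh⟩ := exists_wordLength_eq_cosetLength (e := e) x
      exact mem_image_of_mem _ ((hB r h).2 (hh.trans_le hx))
  obtain ⟨A₁, A₂, hA₁, hA₂, hvol⟩ := exists_coset_volume_bounds hgen hinj hk0 hc
    (hc.trans_le hcC) hdist hc₁ hc₂ hB hcard hV
  obtain ⟨K, hK, M, hM, hupper⟩ := exists_energy_le hgen hc₁ hB fun r hr => (hcard r hr).1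
  obtain ⟨b, hb, hlower⟩ := exists_le_energy hgen hk0 hV hA₁ hA₂ hvol (4 * M)
  set S := lazyGenerators e
  have hS : ∀ s ∈ S, s⁻¹ ∈ S := inv_mem_lazyGenerators
  have h1 : (1 : H) ∈ S := one_mem_lazyGenerators
  have hN : (0 : ℝ) < #S := by exact_mod_cast card_pos.2 ⟨1, h1⟩
  set a : ℝ := b / (2 * K * #S) with ha
  have ha0 : 0 < a := by positivity
  obtain ⟨r₀, hr₀⟩ := exists_nat_ge (2 / a)
  refine ⟨a / 8 / (8 * M) ^ (k / 2), by positivity, 2 * (M * (r₀ + 1) ^ 2), fun n hn => ?_⟩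
  set m := n / 2 with hm
  set r := Nat.sqrt (m / M) with hr
  have hMm : M * (r₀ + 1) ^ 2 ≤ m := by lia
  have hr₀r : r₀ + 1 ≤ r := by
    rw [hr, Nat.le_sqrt', Nat.le_div_iff_mul_le hM]
    linarith
  have hr1 : 1 ≤ r := by lia
  have hr0 : (0 : ℝ) < r := by exact_mod_cast hr1
  have hrm : M * r ^ 2 ≤ m :=
    (Nat.mul_le_mul_left M (Nat.sqrt_le' _)).trans (Nat.mul_div_le m M)
  have hmr : m + 1 ≤ 4 * M * r ^ 2 := by
    have h2 : m / M < (r + 1) ^ 2 := Nat.lt_succ_sqrt' _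
    rw [Nat.div_lt_iff_lt_mul hM] at h2
    calc m + 1 ≤ (r + 1) ^ 2 * M := h2
      _ ≤ (2 * r) ^ 2 * M := by gcongr; lia
      _ = 4 * M * r ^ 2 := by ring
  set f : H →₀ ℝ := (average S (MonoidHom.id H) ^ n) (Finsupp.single 1 1)
  set q : ℤ → ℝ := fun l => f (z ^ l) with hq
  have hf0 : ∀ x, 0 ≤ f x := average_pow_nonneg single_one_nonneg n
  have hqfin : (Function.support q).Finite :=
    (f.hasFiniteSupport.preimage hinj.injOn).subset fun l hl => hl
  have hqle (l : ℤ) : q l ≤ K / (r : ℝ) ^ D :=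
    (average_pow_le_energy hS h1 n _).trans (hupper r m hr1 hrm)
  set Q := ∑' l, q l with hQ
  have hQle : (#S : ℝ)⁻¹ * (b * (r : ℝ) ^ k / (r : ℝ) ^ D) ≤ Q := by
    rw [hQ, hq, tsum_zpow_eq_mapDomain hinj, mapDomain_average_pow]
    refine le_trans ?_ (inv_mul_energy_le hS h1 n)
    gcongr
    exact hlower r m hr1 (by lia)
  have hQ0 : 0 < Q := lt_of_lt_of_le (by positivity) hQle
  have hrk : 2 / a ≤ (r : ℝ) ^ k := by
    have h2 : (r₀ : ℝ) ≤ r := by exact_mod_cast (by lia : r₀ ≤ r)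
    have h3 : (r : ℝ) ^ (1 : ℝ) ≤ (r : ℝ) ^ k :=
      Real.rpow_le_rpow_of_exponent_le (by exact_mod_cast hr1) (by linarith)
    rw [Real.rpow_one] at h3
    linarith
  have hT : (2 * (a / 4 * (r : ℝ) ^ k) + 1) * (K / (r : ℝ) ^ D) ≤ Q / 2 := by
    rw [div_le_iff₀ ha0] at hrk
    calc (2 * (a / 4 * (r : ℝ) ^ k) + 1) * (K / (r : ℝ) ^ D)
        ≤ (a * (r : ℝ) ^ k) * (K / (r : ℝ) ^ D) := by gcongr; linarith
      _ = (#S : ℝ)⁻¹ * (b * (r : ℝ) ^ k / (r : ℝ) ^ D) / 2 := by rw [ha]; field_simp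
      _ ≤ Q / 2 := by gcongr
  have hmain := mul_sub_le_tsum_abs_mul hqfin (fun l => hf0 _) hqle
    (by positivity : 0 ≤ a / 4 * (r : ℝ) ^ k)
  have hnr : (n : ℝ) ^ (k / 2) ≤ (8 * M) ^ (k / 2) * (r : ℝ) ^ k := by
    have h2 : (n : ℝ) ≤ 8 * M * (r : ℝ) ^ 2 := by exact_mod_cast (by lia : n ≤ 8 * M * r ^ 2)
    refine (Real.rpow_le_rpow (by positivity) h2 (by positivity)).trans (le_of_eq ?_)
    rw [Real.mul_rpow (by positivity) (by positivity), ← Real.rpow_natCast, ← Real.rpow_mul hr0.le]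
    congr 2
    push_cast
    ring
  simp only [convPow_lazySRW, mul_left_comm (((|_| : ℤ) : ℝ)), tsum_mul_left]
  rw [mul_div_mul_left _ _ (by positivity), le_div_iff₀ hQ0]
  calc a / 8 / (8 * M) ^ (k / 2) * (n : ℝ) ^ (k / 2) * Q
      ≤ a / 8 / (8 * M) ^ (k / 2) * ((8 * M) ^ (k / 2) * (r : ℝ) ^ k) * Q := by gcongr
    _ = a / 4 * (r : ℝ) ^ k * (Q / 2) := by field_simp; norm_num
    _ ≤ a / 4 * (r : ℝ) ^ k * (Q - (2 * (a / 4 * (r : ℝ) ^ k) + 1) * (K / (r : ℝ) ^ D)) := by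
        gcongr
        linarith
    _ ≤ _ := hmain

end AvgDehnPaper
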